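/- Ajima's Theorem: The radius ρ of γ satisfies ρ = r·(1 − tan(∠BAC/2)·tan(θ/4)). -/

import Mathlib

open EuclideanGeometry Real RealInnerProductSpace Affine

/-- The Euclidean plane. -/
abbrev Plane := EuclideanSpace ℝ (Fin 2)

lemma core_alg (a b c d k K R p be ga pw : ℝ) (ha : 0 < a) (hb : 0 < b) (hc : 0 < c)
    (hk : 0 < k) (hR : 0 < R) (hp : 0 < p) (hd : 2 * d = b^2 + c^2 - a^2)
    (hk2 : k^2 = b^2*c^2 - d^2) (hK : R^2*a^2 = a^4/4 + K^2)
    (hbe : be * k = p * b) (hga : ga * k = p * c) (hle : be + ga ≤ 1)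
    (hpw : a^2 * pw = a^2 * d - 2 * K * k)
    (hE : (1-be-ga)*pw - (a^2*be*ga + b^2*(1-be-ga)*ga + c^2*(1-be-ga)*be) = 2*R*p + p^2) :
    p = k / (a+b+c) * (1 - k/(b*c+d) * (a^2/(2*(R*a-K)))) := by
  have hRK : 0 < R*a - K := by
    have : K^2 < (R*a)^2 := by nlinarith [pow_pos ha 4]
    have := abs_lt_of_sq_lt_sq this (by positivity)
    linarith [(abs_lt.1 this).2]
  have hbcd : 0 < (b*c-d)*(b*c+d) := by nlinarith
  have hm : 0 < b*c+d := by
    by_contra h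
    push Not at h
    have : 0 < b*c := by positivity
    nlinarith
  have hm2 : 2*(b*c+d) = (a+b+c)*(b+c-a) := by linear_combination hd
  have hx : 0 < b+c-a := by
    by_contra h
    push Not at h
    nlinarith [show 0 < a+b+c by positivity]
  obtain ⟨u, hu⟩ : ∃ u, u = a^2/(2*(R*a-K)) := ⟨_, rfl⟩
  obtain ⟨w, hw⟩ : ∃ w, w = 2*(R*a-K)/a^2 := ⟨_, rfl⟩
  obtain ⟨g, hg⟩ : ∃ g, g = k/(b*c+d) := ⟨_, rfl⟩
  have hw0 : 0 < w := by rw [hw]; positivity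
  have hg0 : 0 < g := by rw [hg]; positivity
  have huw : u * w = 1 := by rw [hu, hw]; have := hRK.ne'; generalize R*a-K = z at *; field_simp
  have hw' : a^2 * w = 2*(R*a-K) := by rw [hw]; field_simp
  have hu' : a^2 * u = 2*(R*a+K) := by
    have h : u * (2*(R*a-K)) = a^2 := by rw [hu]; have := hRK.ne'; generalize R*a-K = z at *; field_simp
    have : (a^2 * u - 2*(R*a+K)) * (R*a-K) = 0 := by linear_combination a^2*h/2 - 2*hK
    rcases mul_eq_zero.1 this with h | h
    · linarith
    · exact absurd h hRK.ne'
  have hRe : R = a*(u+w)/4 := by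
    have : a * (R - a*(u+w)/4) = 0 := by linear_combination -(hu'+hw')/4
    rcases mul_eq_zero.1 this with h | h
    · exact absurd h ha.ne'
    · linarith
  have hKe : K = a^2*(u-w)/4 := by linear_combination -(hu'-hw')/4
  have hpe : pw = d - k*(u-w)/2 := by
    have : a^2 * (pw - (d - k*(u-w)/2)) = 0 := by
      rw [hKe] at hpw
      linear_combination hpw
    rcases mul_eq_zero.1 this with h | h
    · exact absurd h (by positivity)
    · linarith
  have hgm : g * (b*c+d) = k := by rw [hg]; field_simp
  have hgk : g * k = b*c - d := by
    rw [hg]; field_simp; linear_combination hk2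
  rw [← hg, ← hu]
  have hbe' : be = p*b/k := by field_simp; exact hbe
  have hga' : ga = p*c/k := by field_simp; exact hga
  have hF : (p*(a+b+c) - k*(1-g*u)) * (p*(b+c-a) - k*(1+g*w)) = 0 := by
    have hE2 : (k^2 - k*p*(b+c))*pw - a^2*b*c*p^2 - (k-p*(b+c))*p*b*c*(b+c)
        - k^2*p^2 - 2*k^2*R*p = 0 := by
      rw [hbe', hga'] at hE
      field_simp at hE
      linear_combination hE
    have : (b*c+d)/2 * ((p*(a+b+c) - k*(1-g*u)) * (p*(b+c-a) - k*(1+g*w))) = 0 := by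
      rw [hpe, hRe] at hE2
      have e1 : (b*c+d)/2 * ((p*(a+b+c) - k*(1-g*u)) * (p*(b+c-a) - k*(1+g*w)))
        = (b*c+d)/2 * (p^2*((a+b+c)*(b+c-a)) - 2*p*k*(b+c) + k^2)
         - p*k*(g*(b*c+d))/2 * ((a+b+c)*w - (b+c-a)*u) + k^2*(g*(b*c+d))/2*(w-u)
         - k^2*((g*(b*c+d))*g)/2*(u*w) := by ring
      rw [e1, ← hm2, huw, hgm, mul_comm k g, hgk]
      have ha2 : a^2 = b^2+c^2-2*d := by linarith
      rw [ha2] at hE2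
      linear_combination hE2 + p^2*hk2
    rcases mul_eq_zero.1 this with h | h
    · linarith
    · exact h
  rcases mul_eq_zero.1 hF with h | h
  · field_simp
    linear_combination h
  · exfalso
    have h1 : p*(b+c) ≤ k := by
      have := mul_le_mul_of_nonneg_right hle hk.le
      linarith
    have h2 : 0 < p * a := by positivity
    have h3 : 0 < k*(g*w) := by positivity
    linarith

lemma dist_sq_coord (P Q : Plane) : dist P Q ^ 2 = (P 0 - Q 0)^2 + (P 1 - Q 1)^2 := by
  rw [EuclideanSpace.dist_eq, Real.sq_sqrt (by positivity)]
  simp [Fin.sum_univ_two, Real.dist_eq, sq_abs]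

lemma infDist_line (X P Q : Plane) (h : P ≠ Q) :
    Metric.infDist X (affineSpan ℝ ({P, Q} : Set Plane) : Set Plane) * dist P Q
      = |(Q 0 - P 0) * (X 1 - P 1) - (Q 1 - P 1) * (X 0 - P 0)| := by
  have hd : 0 < dist P Q := dist_pos.2 h
  have hdsq := dist_sq_coord P Q
  apply le_antisymm
  · obtain ⟨t, ht⟩ : ∃ t, t = ((Q 0 - P 0) * (X 0 - P 0) + (Q 1 - P 1) * (X 1 - P 1)) / dist P Q ^ 2 := ⟨_, rfl⟩
    have ht' : t * dist P Q ^ 2 = ((Q 0 - P 0) * (X 0 - P 0) + (Q 1 - P 1) * (X 1 - P 1)) := by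
      rw [ht]; field_simp
    have hm : AffineMap.lineMap P Q t ∈ (affineSpan ℝ ({P, Q} : Set Plane) : Set Plane) :=
      AffineMap.lineMap_mem_affineSpan_pair t P Q
    have h1 := Metric.infDist_le_dist_of_mem (x := X) hm
    refine le_trans (mul_le_mul_of_nonneg_right h1 hd.le) ?_
    apply abs_le_of_sq_le_sq' _ (abs_nonneg _) |>.2
    rw [mul_pow, sq_abs, dist_sq_coord X]
    simp only [AffineMap.lineMap_apply, vsub_eq_sub, vadd_eq_add, PiLp.add_apply, PiLp.smul_apply, PiLp.sub_apply, smul_eq_mul]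
    apply le_of_eq
    generalize dist P Q = e at *
    rw [hdsq] at ht' ⊢
    linear_combination (-((Q 0 - P 0) * (X 0 - P 0) + (Q 1 - P 1) * (X 1 - P 1)) + t*((P 0 - Q 0)^2 + (P 1 - Q 1)^2)) * ht'
  · rw [← div_le_iff₀ hd]
    rw [Metric.le_infDist ⟨P, left_mem_affineSpan_pair ℝ P Q⟩]
    intro Y hY
    obtain ⟨t, rfl⟩ := mem_affineSpan_pair_iff_exists_lineMap_eq.1 hY
    rw [div_le_iff₀ hd]
    apply abs_le_of_sq_le_sq' _ (by positivity) |>.2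
    rw [mul_pow, sq_abs, dist_sq_coord X, hdsq]
    simp only [AffineMap.lineMap_apply, vsub_eq_sub, vadd_eq_add, PiLp.add_apply, PiLp.smul_apply, PiLp.sub_apply, smul_eq_mul]
    have := sq_nonneg ((X 0 - (t * (Q 0 - P 0) + P 0))*(Q 0 - P 0) + (X 1 - (t * (Q 1 - P 1) + P 1))*(Q 1 - P 1))
    linarith

lemma hull_coords (A B C P : Plane) (h : AffineIndependent ℝ ![A, B, C])
    (hP : P ∈ convexHull ℝ ({A, B, C} : Set Plane)) :
    ∃ be ga : ℝ, 0 ≤ be ∧ 0 ≤ ga ∧ be + ga ≤ 1 ∧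
      (P ∈ interior (convexHull ℝ ({A, B, C} : Set Plane)) → be + ga < 1) ∧
      ∀ i, P i - A i = be * (B i - A i) + ga * (C i - A i) := by
  have htop : affineSpan ℝ (Set.range ![A, B, C]) = ⊤ := by
    rw [h.affineSpan_eq_top_iff_card_eq_finrank_add_one]; simp
  let b : AffineBasis (Fin 3) ℝ Plane := ⟨![A,B,C], h, htop⟩
  have hr : ({A, B, C} : Set Plane) = Set.range b := by
    change _ = Set.range ![A,B,C]
    ext x; simp [Matrix.range_cons, Matrix.range_empty]; tauto
  have hb := b.linear_combination_coord_eq_self P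
  have hs := b.sum_coord_apply_eq_one P
  rw [Fin.sum_univ_three] at hb hs
  have b0 : b 0 = A := rfl
  have b1 : b 1 = B := rfl
  have b2 : b 2 = C := rfl
  rw [hr] at hP ⊢
  rw [b.interior_convexHull]
  rw [b.convexHull_eq_nonneg_coord] at hP
  refine ⟨b.coord 1 P, b.coord 2 P, hP 1, hP 2, ?_, ?_, ?_⟩
  · linarith [hP 0]
  · intro h; linarith [h 0]
  · intro i
    have := congrArg (fun x : Plane => x i) hb
    simp only [b0, b1, b2, PiLp.add_apply, PiLp.smul_apply, smul_eq_mul] at this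
    linear_combination -this + A i * hs

lemma tan_half_vec (x y : Plane) (h : 0 < ‖x‖ * ‖y‖ + (x 0 * y 0 + x 1 * y 1)) :
    Real.tan (InnerProductGeometry.angle x y / 2) =
      |x 0 * y 1 - x 1 * y 0| / (‖x‖ * ‖y‖ + (x 0 * y 0 + x 1 * y 1)) := by
  have hin : ∀ x y : Plane, inner ℝ x y = x 0 * y 0 + x 1 * y 1 := by
    intro x y
    simp [PiLp.inner_apply, Fin.sum_univ_two, mul_comm]
  have hc := InnerProductGeometry.cos_angle_mul_norm_mul_norm x y
  have hs := InnerProductGeometry.sin_angle_mul_norm_mul_norm x y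
  rw [hin, hin, hin, show (x 0 * x 0 + x 1 * x 1) * (y 0 * y 0 + y 1 * y 1) -
    (x 0 * y 0 + x 1 * y 1) * (x 0 * y 0 + x 1 * y 1) = (x 0 * y 1 - x 1 * y 0)^2 by ring,
    Real.sqrt_sq_eq_abs] at hs
  rw [hin] at hc
  rw [← hc] at h
  rw [← hs, ← hc]
  set p := InnerProductGeometry.angle x y
  have e : p = 2 * (p/2) := by ring
  have hN : 0 < ‖x‖ * ‖y‖ := by
    rcases (by positivity : 0 ≤ ‖x‖ * ‖y‖).eq_or_lt with h0 | h0
    · rw [← h0] at h; simp at h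
    · exact h0
  have h1 : Real.sin p = 2 * Real.sin (p/2) * Real.cos (p/2) := by rw [← Real.sin_two_mul, ← e]
  have h2 : Real.cos p = 2 * Real.cos (p/2)^2 - 1 := by rw [← Real.cos_two_mul, ← e]
  have hc0 : Real.cos (p/2) ≠ 0 := by
    intro h0
    rw [h2, h0] at h
    simp at h
  rw [Real.tan_eq_sin_div_cos, h1, h2]
  rw [div_eq_div_iff hc0 (by rw [h2] at h; exact h.ne')]
  ring

lemma tan_A (P A Q : Plane)
    (h : 0 < dist A P * dist A Q + ((P 0 - A 0) * (Q 0 - A 0) + (P 1 - A 1) * (Q 1 - A 1))) :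
    Real.tan (∠ P A Q / 2) = |(P 0 - A 0) * (Q 1 - A 1) - (P 1 - A 1) * (Q 0 - A 0)| /
      (dist A P * dist A Q + ((P 0 - A 0) * (Q 0 - A 0) + (P 1 - A 1) * (Q 1 - A 1))) := by
  rw [dist_comm A P, dist_comm A Q, dist_eq_norm, dist_eq_norm] at *
  exact tan_half_vec (P - A) (Q - A) h

lemma tan_T (P A Q : Plane)
    (h : 0 < dist A P * dist A Q - ((P 0 - A 0) * (Q 0 - A 0) + (P 1 - A 1) * (Q 1 - A 1))) :
    Real.tan ((2 * (π - ∠ P A Q)) / 4) = |(P 0 - A 0) * (Q 1 - A 1) - (P 1 - A 1) * (Q 0 - A 0)| /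
      (dist A P * dist A Q - ((P 0 - A 0) * (Q 0 - A 0) + (P 1 - A 1) * (Q 1 - A 1))) := by
  rw [show (2 * (π - ∠ P A Q)) / 4 = (π - ∠ P A Q) / 2 by ring]
  rw [dist_eq_norm, dist_comm A Q, dist_eq_norm] at *
  have e : π - ∠ P A Q = InnerProductGeometry.angle (A - P) (Q - A) := by
    rw [EuclideanGeometry.angle, ← InnerProductGeometry.angle_neg_left]
    simp
  have k := tan_half_vec (A - P) (Q - A) (by
    simp only [PiLp.sub_apply]; linarith)
  rw [e, k]
  simp only [PiLp.sub_apply]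
  congr 1
  · rw [← abs_neg]; congr 1; ring
  · ring

set_option maxHeartbeats 2000000 in
/-- **Ajima's Theorem.** In the Ajima-circle configuration, with
`θ := 2(π − ∠ B T C)` the angular measure of the arc of `ω` on the side of `A`, the
radius `ρ` of `γ` satisfies `ρ = r (1 − tan(A/2) tan(θ/4))`. -/
theorem ajima_theorem
    (A B C I Oω D T : Plane) (r Rω ρ : ℝ)
    (hABC : AffineIndependent ℝ ![A, B, C])
    (hr : 0 < r)
    (hIin : I ∈ interior (convexHull ℝ ({A, B, C} : Set Plane)))
    (hIab : Metric.infDist I (affineSpan ℝ ({A, B} : Set Plane) : Set Plane) = r)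
    (hIbc : Metric.infDist I (affineSpan ℝ ({B, C} : Set Plane) : Set Plane) = r)
    (hIca : Metric.infDist I (affineSpan ℝ ({C, A} : Set Plane) : Set Plane) = r)
    (hRω : 0 < Rω) (hρ : 0 < ρ)
    (hBω : dist B Oω = Rω) (hCω : dist C Oω = Rω)
    (hγin : Metric.sphere D ρ ⊆ convexHull ℝ ({A, B, C} : Set Plane))
    (hγAB : Metric.infDist D (affineSpan ℝ ({A, B} : Set Plane) : Set Plane) = ρ)
    (hγAC : Metric.infDist D (affineSpan ℝ ({A, C} : Set Plane) : Set Plane) = ρ)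
    (hext : dist Oω D = Rω + ρ)
    (hTω : dist T Oω = Rω) (hTγ : dist T D = ρ)
    (hTseg : Wbtw ℝ Oω T D)
    (hTin : T ∈ interior (convexHull ℝ ({A, B, C} : Set Plane)))
 :
    ρ = r * (1 - Real.tan (∠ B A C / 2) * Real.tan ((2 * (π - ∠ B T C)) / 4)) := by
  have hAB : A ≠ B := fun h => by simpa using hABC.injective.ne (show (0 : Fin 3) ≠ 1 by decide) h
  have hAC : A ≠ C := fun h => by simpa using hABC.injective.ne (show (0 : Fin 3) ≠ 2 by decide) h
  have hBC : B ≠ C := fun h => by simpa using hABC.injective.ne (show (1 : Fin 3) ≠ 2 by decide) h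
  -- the centre of γ lies in the triangle
  have hDin : D ∈ convexHull ℝ ({A, B, C} : Set Plane) := by
    have hn : ‖(EuclideanSpace.single 0 ρ : Plane)‖ = ρ := by
      simp [abs_of_pos hρ]
    have h1 : D + EuclideanSpace.single 0 ρ ∈ convexHull ℝ ({A, B, C} : Set Plane) :=
      hγin (by rw [mem_sphere_iff_norm, add_sub_cancel_left, hn])
    have h2 : D - EuclideanSpace.single 0 ρ ∈ convexHull ℝ ({A, B, C} : Set Plane) :=
      hγin (by rw [mem_sphere_iff_norm, sub_sub_cancel_left, norm_neg, hn])
    have h3 := (convex_convexHull ℝ ({A, B, C} : Set Plane)) h1 h2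
      (show (0:ℝ) ≤ 1/2 by norm_num) (show (0:ℝ) ≤ 1/2 by norm_num) (by norm_num)
    convert h3 using 1
    module
  obtain ⟨bI, gI, hbI, hgI, hsI, -, hI⟩ := hull_coords A B C I hABC (interior_subset hIin)
  obtain ⟨bD, gD, hbD, hgD, hsD, -, hD⟩ := hull_coords A B C D hABC hDin
  obtain ⟨bT, gT, hbT, hgT, -, hsT, hT⟩ := hull_coords A B C T hABC (interior_subset hTin)
  replace hsT := hsT hTin
  have lIab := infDist_line I A B hAB
  have lIbc := infDist_line I B C hBC
  have lIca := infDist_line I C A hAC.symm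
  have lDab := infDist_line D A B hAB
  have lDac := infDist_line D A C hAC
  rw [hIab] at lIab
  rw [hIbc] at lIbc
  rw [hIca, dist_comm] at lIca
  rw [hγAB] at lDab
  rw [hγAC] at lDac
  have hc0 : 0 < dist A B := dist_pos.2 hAB
  have hb0 : 0 < dist A C := dist_pos.2 hAC
  have ha0 : 0 < dist B C := dist_pos.2 hBC
  have hc2 := dist_sq_coord A B
  have hb2 := dist_sq_coord A C
  have ha2 := dist_sq_coord B C
  have hB2 := dist_sq_coord B Oω
  have hC2 := dist_sq_coord C Oω
  have hT2 := dist_sq_coord T Oω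
  have hD2 := dist_sq_coord Oω D
  rw [hBω] at hB2
  rw [hCω] at hC2
  rw [hTω] at hT2
  rw [hext] at hD2
  have hTB2 := dist_sq_coord T B
  have hTC2 := dist_sq_coord T C
  have tA := tan_A B A C
  have tT := tan_T B T C
  have eT0 : T 0 = A 0 + bT * (B 0 - A 0) + gT * (C 0 - A 0) := by linear_combination hT 0
  have eT1 : T 1 = A 1 + bT * (B 1 - A 1) + gT * (C 1 - A 1) := by linear_combination hT 1
  have eD0 : D 0 = A 0 + bD * (B 0 - A 0) + gD * (C 0 - A 0) := by linear_combination hD 0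
  have eD1 : D 1 = A 1 + bD * (B 1 - A 1) + gD * (C 1 - A 1) := by linear_combination hD 1
  have eI0 : I 0 = A 0 + bI * (B 0 - A 0) + gI * (C 0 - A 0) := by linear_combination hI 0
  have eI1 : I 1 = A 1 + bI * (B 1 - A 1) + gI * (C 1 - A 1) := by linear_combination hI 1
  have hTB0 : 0 ≤ dist T B := dist_nonneg
  have hTC0 : 0 ≤ dist T C := dist_nonneg
  generalize dist T B = tb at *
  generalize dist T C = tc at *
  generalize dist A B = c at *
  generalize dist A C = b at *
  generalize dist B C = a at *
  generalize Real.tan (∠ B A C / 2) = tanA at *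
  generalize Real.tan ((2 * (π - ∠ B T C)) / 4) = tanT at *
  rw [eT0, eT1] at hT2
  rw [eD0, eD1] at hD2
  rw [eT0, eT1] at *
  rw [eD0, eD1] at *
  rw [eI0, eI1] at *
  clear hABC hIin hIab hIbc hIca hBω hCω hγin hγAB hγAC hext hTω hTγ hTseg hTin hDin hI hD hT
  clear eT0 eT1 eD0 eD1 eI0 eI1
  generalize A 0 = A0 at *
  generalize A 1 = A1 at *
  generalize B 0 = B0 at *
  generalize B 1 = B1 at *
  generalize C 0 = C0 at *
  generalize C 1 = C1 at *
  generalize Oω 0 = O0 at *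
  generalize Oω 1 = O1 at *
  obtain ⟨κ, hκ⟩ : ∃ κ, κ = (B0 - A0) * (C1 - A1) - (B1 - A1) * (C0 - A0) := ⟨_, rfl⟩
  have kI1 : r * c = gI * |κ| := by
    rw [lIab, ← abs_of_nonneg hgI, ← abs_mul, hκ]; simp only [abs_of_nonneg hgI]; ring_nf
  have kI2 : r * b = bI * |κ| := by
    rw [lIca, ← abs_of_nonneg hbI, ← abs_mul, hκ]; simp only [abs_of_nonneg hbI]; ring_nf
  have kI3 : r * a = (1 - bI - gI) * |κ| := by
    have h0 : 0 ≤ 1 - bI - gI := by linarith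
    rw [lIbc, ← abs_of_nonneg h0, ← abs_mul, hκ]; simp only [abs_of_nonneg h0]; ring_nf
  have kD1 : ρ * c = gD * |κ| := by
    rw [lDab, ← abs_of_nonneg hgD, ← abs_mul, hκ]; simp only [abs_of_nonneg hgD]; ring_nf
  have kD2 : ρ * b = bD * |κ| := by
    rw [lDac, ← abs_of_nonneg hbD, ← abs_mul, hκ]; simp only [abs_of_nonneg hbD]
    rw [← abs_neg]; ring_nf
  have hκ0 : κ ≠ 0 := by
    rintro h
    rw [h, abs_zero, mul_zero] at kI1
    have : 0 < r * c := by positivity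
    linarith
  have hk0 : 0 < |κ| := abs_pos.2 hκ0
  obtain ⟨ε, hε, hεκ⟩ : ∃ ε : ℝ, ε * ε = 1 ∧ |κ| = ε * κ := by
    rcases abs_choice κ with h | h
    · exact ⟨1, by norm_num, by rw [h, one_mul]⟩
    · exact ⟨-1, by norm_num, by rw [h]; ring⟩
  obtain ⟨K, hKd⟩ : ∃ K, K = ε * ((C0 - B0) * (O1 - B1) - (C1 - B1) * (O0 - B0)) := ⟨_, rfl⟩
  obtain ⟨d, hd⟩ : ∃ d, d = (B0 - A0) * (C0 - A0) + (B1 - A1) * (C1 - A1) := ⟨_, rfl⟩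
  have hk2 : |κ|^2 = b^2*c^2 - d^2 := by
    rw [sq_abs, hκ, hb2, hc2, hd]; ring
  have hperp : 2*((C0 - B0) * (O0 - B0) + (C1 - B1) * (O1 - B1)) = a^2 := by
    rw [ha2]; linear_combination hC2 - hB2
  have hK : Rω^2*a^2 = a^4/4 + K^2 := by
    have : K^2 = ((C0 - B0) * (O1 - B1) - (C1 - B1) * (O0 - B0))^2 := by
      rw [hKd]; linear_combination ((C0 - B0) * (O1 - B1) - (C1 - B1) * (O0 - B0))^2 * hε
    rw [this, show a^4 = a^2*a^2 by ring]
    nth_rw 2 [← hperp]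
    nth_rw 2 [← hperp]
    rw [hB2, ha2]
    ring
  have hKk : K * |κ| = ((C0 - B0) * (O1 - B1) - (C1 - B1) * (O0 - B0)) * κ := by
    rw [hKd, hεκ]
    linear_combination ((C0 - B0) * (O1 - B1) - (C1 - B1) * (O0 - B0)) * κ * hε
  have hRK : 0 < Rω*a - K := by
    have : K^2 < (Rω*a)^2 := by rw [mul_pow]; linarith [pow_pos ha0 4]
    have := abs_lt_of_sq_lt_sq this (by positivity)
    linarith [(abs_lt.1 this).2]
  have hbcd : 0 < b*c + d := by
    have h1 : d^2 < (b*c)^2 := by rw [mul_pow]; linarith [pow_pos hk0 2]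
    have := abs_lt_of_sq_lt_sq h1 (by positivity)
    linarith [(abs_lt.1 this).1]
  have hbcd' : c*b + d = b*c+d := by ring
  rw [← hd, ← hκ, hbcd'] at tA
  replace tA := tA hbcd
  obtain ⟨e, he⟩ : ∃ e, e = (B0 - (A0 + bT * (B0 - A0) + gT * (C0 - A0))) * (C0 - (A0 + bT * (B0 - A0) + gT * (C0 - A0))) + (B1 - (A1 + bT * (B1 - A1) + gT * (C1 - A1))) * (C1 - (A1 + bT * (B1 - A1) + gT * (C1 - A1))) := ⟨_, rfl⟩
  have hα : 0 < 1 - bT - gT := by linarith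
  have hcr : (B0 - (A0 + bT * (B0 - A0) + gT * (C0 - A0))) * (C1 - (A1 + bT * (B1 - A1) + gT * (C1 - A1))) - (B1 - (A1 + bT * (B1 - A1) + gT * (C1 - A1))) * (C0 - (A0 + bT * (B0 - A0) + gT * (C0 - A0))) = (1 - bT - gT) * κ := by
    rw [hκ]; ring
  rw [← he, hcr, abs_mul, abs_of_pos hα] at tT
  have he1 : a^2 * e = 2 * K * |κ| * (1 - bT - gT) := by
    have h1 : 2 * K * |κ| * (1 - bT - gT) = 2 * ((C0 - B0) * (O1 - B1) - (C1 - B1) * (O0 - B0)) * ((1 - bT - gT) * κ) := by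
      linear_combination 2 * (1 - bT - gT) * hKk
    rw [h1, ← hcr, he, ha2]
    clear * - hB2 hC2 hT2
    generalize A0 + bT * (B0 - A0) + gT * (C0 - A0) = T0 at *
    generalize A1 + bT * (B1 - A1) + gT * (C1 - A1) = T1 at *
    linear_combination ((B0-T0)*(C0-B0)+(B1-T1)*(C1-B1)) * (hT2 - hC2) - ((C0-T0)*(C0-B0)+(C1-T1)*(C1-B1)) * (hT2 - hB2)
  have hN : a^2 * (tb*tc) = 2 * Rω * a * |κ| * (1 - bT - gT) := by
    have h1 : (tb*tc)^2 = e^2 + ((1 - bT - gT) * κ)^2 := by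
      rw [mul_pow, hTB2, hTC2, he, ← hcr]; ring
    rw [← sq_eq_sq₀ (by positivity) (by positivity)]
    have h2 : |κ|^2 = κ^2 := sq_abs κ
    linear_combination a^4 * h1 + (a^2*e + 2 * K * |κ| * (1 - bT - gT)) * he1
      - 4 * |κ|^2 * (1 - bT - gT)^2 * hK - a^4 * (1 - bT - gT)^2 * h2
  have hNe : a^2 * (tb*tc - e) = 2*(Rω*a - K) * (|κ| * (1 - bT - gT)) := by
    linear_combination hN - he1
  have hNe0 : 0 < tb*tc - e := by
    have : 0 < a^2 * (tb*tc - e) := by rw [hNe]; positivity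
    exact pos_of_mul_pos_right this (by positivity)
  replace tT := tT hNe0
  have tT' : tanT = a^2/(2*(Rω*a-K)) := by
    rw [tT, div_eq_div_iff hNe0.ne' (by positivity)]
    linear_combination -hNe
  have hr' : r = |κ| / (a+b+c) := by
    rw [eq_div_iff (by positivity)]
    linear_combination kI1 + kI2 + kI3
  rw [tT', tA, hr']
  refine core_alg a b c d |κ| K Rω ρ bD gD ((A0-O0)^2 + (A1-O1)^2 - Rω^2) ha0 hb0 hc0 hk0 hRω hρ
    ?_ hk2 hK kD2.symm kD1.symm hsD ?_ ?_
  · rw [hd, ha2, hb2, hc2]; ring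
  · rw [show a^2 * d - 2 * K * |κ| = a^2 * d - 2 * (K * |κ|) by ring, hKk, hκ, hd, ha2]
    clear * - hB2 hC2
    linear_combination ((C0-A0)*(C0-B0)+(C1-A1)*(C1-B1)) * (-hB2) + ((B0-A0)*(C0-B0)+(B1-A1)*(C1-B1)) * hC2
  · rw [ha2, hb2, hc2]
    linear_combination -hD2 + bD * hB2 + gD * hC2
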